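/- For every simple graph G, eq(L(G)) ≤ inelb(G): given an in-elbow cover of G by a family O of orientations, the line graph L(G) can be covered by |O| equivalence graphs, where in the equivalence graph corresponding to an orientation the clique at a vertex v of G consists of all edges directed towards v. -/

import Mathlib

open SimpleGraph

/-- A graph is chordal if it has no induced cycle of length more than three. -/
def IsChordal {V : Type*} (G : SimpleGraph V) : Prop :=
  ∀ n : ℕ, 3 < n → IsEmpty (cycleGraph n ↪g G)

/-- A graph is an interval graph if it is the intersection graph of a family of
closed real intervals. -/
def IsIntervalGraph {V : Type*} (G : SimpleGraph V) : Prop :=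
  ∃ a b : V → ℝ, (∀ v, a v ≤ b v) ∧
    ∀ u v, G.Adj u v ↔ u ≠ v ∧ (Set.Icc (a u) (b u) ∩ Set.Icc (a v) (b v)).Nonempty

/-- A graph is an equivalence graph if it is a disjoint union of cliques. -/
def IsEquivalenceGraph {V : Type*} (G : SimpleGraph V) : Prop :=
  ∀ u v w, G.Adj u v → G.Adj v w → u ≠ w → G.Adj u w

/-- The minimum number of graphs satisfying `P` whose (edge-)union is `G`. -/
noncomputable def coverNumber {V : Type*} (P : SimpleGraph V → Prop)
    (G : SimpleGraph V) : ℕ :=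
  sInf {k | ∃ f : Fin k → SimpleGraph V, (∀ i, P (f i)) ∧ (⨆ i, f i) = G}

/-- The chordal covering number. -/
noncomputable def chordalCoverNumber {V : Type*} (G : SimpleGraph V) : ℕ :=
  coverNumber IsChordal G

/-- The track number. -/
noncomputable def trackNumber {V : Type*} (G : SimpleGraph V) : ℕ :=
  coverNumber IsIntervalGraph G

/-- The equivalence covering number. -/
noncomputable def eqCoverNumber {V : Type*} (G : SimpleGraph V) : ℕ :=
  coverNumber IsEquivalenceGraph G

/-- An orientation of a simple graph: each edge gets exactly one of its two directions. -/
structure GraphOrientation {V : Type*} (G : SimpleGraph V) where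
  dir : V → V → Prop
  adj_iff : ∀ u v, G.Adj u v ↔ (dir u v ∨ dir v u)
  asymm : ∀ u v, dir u v → ¬ dir v u

/-- Edges `xy` and `xz` form an elbow at `x`: both towards `x` or both away from `x`. -/
def GraphOrientation.IsElbow {V : Type*} {G : SimpleGraph V} (o : GraphOrientation G)
    (x y z : V) : Prop :=
  (o.dir y x ∧ o.dir z x) ∨ (o.dir x y ∧ o.dir x z)

/-- Edges `xy` and `xz` form an in-elbow at `x`: both directed towards `x`. -/
def GraphOrientation.IsInElbow {V : Type*} {G : SimpleGraph V} (o : GraphOrientation G)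
    (x y z : V) : Prop :=
  o.dir y x ∧ o.dir z x

/-- The minimum size of an elbow cover of `G`. -/
noncomputable def elbowCoverNumber {V : Type*} (G : SimpleGraph V) : ℕ :=
  sInf {k | ∃ f : Fin k → GraphOrientation G,
    ∀ x y z, G.Adj x y → G.Adj x z → y ≠ z → ∃ i, (f i).IsElbow x y z}

/-- The minimum size of an in-elbow cover of `G`. -/
noncomputable def inElbowCoverNumber {V : Type*} (G : SimpleGraph V) : ℕ :=
  sInf {k | ∃ f : Fin k → GraphOrientation G,
    ∀ x y z, G.Adj x y → G.Adj x z → y ≠ z → ∃ i, (f i).IsInElbow x y z}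

/-- The vertex `v` is the head of the edge `e` under the orientation `o`. -/
def GraphOrientation.IsHead {V : Type*} {G : SimpleGraph V} (o : GraphOrientation G)
    (e : Sym2 V) (v : V) : Prop :=
  ∃ u, o.dir u v ∧ e = s(u, v)

theorem GraphOrientation.IsHead.unique {V : Type*} {G : SimpleGraph V} {o : GraphOrientation G}
    {e : Sym2 V} {v w : V} (hv : o.IsHead e v) (hw : o.IsHead e w) : v = w := by
  obtain ⟨a, ha, rfl⟩ := hv
  obtain ⟨b, hb, h⟩ := hw
  rcases Sym2.eq_iff.1 h with ⟨-, h⟩ | ⟨rfl, rfl⟩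
  · exact h
  · exact absurd hb (o.asymm _ _ ha)

/-- The graph on the edges of `G` in which two edges are adjacent iff they have the same head. -/
def GraphOrientation.headGraph {V : Type*} {G : SimpleGraph V} (o : GraphOrientation G) :
    SimpleGraph G.edgeSet where
  Adj e f := e ≠ f ∧ ∃ v, o.IsHead e v ∧ o.IsHead f v
  symm := ⟨fun _ _ ⟨hne, v, he, hf⟩ => ⟨hne.symm, v, hf, he⟩⟩
  loopless := ⟨fun _ h => h.1 rfl⟩

theorem GraphOrientation.isEquivalenceGraph_headGraph {V : Type*} {G : SimpleGraph V}
    (o : GraphOrientation G) : IsEquivalenceGraph o.headGraph := by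
  rintro e f g ⟨-, v, he, hf⟩ ⟨-, w, hf', hg⟩ hne
  obtain rfl := hf.unique hf'
  exact ⟨hne, v, he, hg⟩

theorem GraphOrientation.headGraph_le_lineGraph {V : Type*} {G : SimpleGraph V}
    (o : GraphOrientation G) : o.headGraph ≤ G.lineGraph := by
  rintro e f ⟨hne, v, ⟨a, -, he⟩, ⟨b, -, hf⟩⟩
  exact lineGraph_adj_iff_exists.2 ⟨hne, v, by simp [he], by simp [hf]⟩

/-- The head graphs of an in-elbow cover of `G` cover the line graph of `G`. -/
theorem iSup_headGraph_eq_lineGraph {V ι : Type*} {G : SimpleGraph V}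
    (f : ι → GraphOrientation G)
    (hf : ∀ x y z, G.Adj x y → G.Adj x z → y ≠ z → ∃ i, (f i).IsInElbow x y z) :
    ⨆ i, (f i).headGraph = G.lineGraph := by
  refine le_antisymm (iSup_le fun i => (f i).headGraph_le_lineGraph) ?_
  rintro ⟨d, hd⟩ ⟨e, he⟩ h
  obtain ⟨hne, x, hxd, hxe⟩ := lineGraph_adj_iff_exists.1 h
  obtain ⟨y, rfl⟩ := Sym2.mem_iff_exists.1 hxd
  obtain ⟨z, rfl⟩ := Sym2.mem_iff_exists.1 hxe
  obtain ⟨i, hy, hz⟩ := hf x y z hd he (by rintro rfl; exact hne rfl)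
  exact SimpleGraph.iSup_adj.2 ⟨i, hne, x, ⟨y, hy, Sym2.eq_swap⟩, ⟨z, hz, Sym2.eq_swap⟩⟩

/-- An orientation of `G` in which all edges at `x` are directed towards `x`. -/
def GraphOrientation.towards {V : Type*} (G : SimpleGraph V) (x : V) : GraphOrientation G where
  dir u v := G.Adj u v ∧ (v = x ∨ u ≠ x ∧ WellOrderingRel u v)
  adj_iff u v := by
    have htri := trichotomous_of (WellOrderingRel (α := V)) u v
    have hne : G.Adj u v → u ≠ v := SimpleGraph.Adj.ne
    rw [G.adj_comm v u]
    grind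
  asymm u v := by
    rintro ⟨h, h₁⟩ ⟨-, h₂⟩
    have hasymm : WellOrderingRel u v → ¬ WellOrderingRel v u := asymm_of _
    have hne := h.ne
    grind

theorem exists_inElbow_cover {V : Type*} [Fintype V] (G : SimpleGraph V) :
    ∃ k, ∃ f : Fin k → GraphOrientation G,
      ∀ x y z, G.Adj x y → G.Adj x z → y ≠ z → ∃ i, (f i).IsInElbow x y z := by
  refine ⟨Fintype.card V,
    fun i => GraphOrientation.towards G ((Fintype.equivFin V).symm i), ?_⟩
  intro x y z hy hz _
  refine ⟨Fintype.equivFin V x, ?_⟩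
  simp [GraphOrientation.IsInElbow, GraphOrientation.towards, hy.symm, hz.symm]

theorem stmt_6 {V : Type*} [Fintype V] (G : SimpleGraph V) :
    eqCoverNumber G.lineGraph ≤ inElbowCoverNumber G := by
  obtain ⟨f, hf⟩ := Nat.sInf_mem (exists_inElbow_cover G)
  exact Nat.sInf_le ⟨fun i => (f i).headGraph, fun i => (f i).isEquivalenceGraph_headGraph,
    iSup_headGraph_eq_lineGraph f hf⟩
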